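/- Let σ² > 0, B > 0, g̃ > 0, λ > 0, μ ≥ 0, p_c ≥ 0, and ω, θ be reals with ω − θ > λ·σ²·ln 2/(B·g̃). Define β(x) = σ²·(2^{x/B} − 1), F(t, ℓ) = (ω − θ)·ℓ − (λ·t/g̃)·β(ℓ/t) − μ·t − λ·p_c·t, and the optimal offloading rate r* = B·log₂( (ω − θ)·B·g̃ / (λ·σ²·ln 2) ). Then for every fixed t > 0 and every ℓ ≥ 0, F(t, ℓ) ≤ F(t, r*·t); i.e., for each positive offloading time t the choice ℓ = r*·t of offloaded bits maximizes the objective over ℓ ∈ [0, ∞). -/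

import Mathlib

/-- The graph of `x ↦ 2 ^ x` lies above its tangent line at `s`. -/
theorem two_rpow_tangent_le (s x : ℝ) :
    (2 : ℝ) ^ s + (2 : ℝ) ^ s * Real.log 2 * (x - s) ≤ (2 : ℝ) ^ x := by
  have hsplit : (2 : ℝ) ^ x = (2 : ℝ) ^ s * Real.exp (Real.log 2 * (x - s)) := by
    rw [← Real.rpow_def_of_pos two_pos, ← Real.rpow_add two_pos, add_sub_cancel]
  have hexp := mul_le_mul_of_nonneg_left (Real.add_one_le_exp (Real.log 2 * (x - s)))
    (Real.rpow_nonneg zero_le_two s)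
  rw [hsplit]
  linarith

/-- If `ω − θ > λ·σ²·ln 2/(B·g̃)`, then for each fixed offloading time `t > 0`, the choice
`ℓ = r*·t` with `r* = B·log₂((ω − θ)·B·g̃/(λ·σ²·ln 2))` maximizes the per-user Lagrangian
offloading objective `F(t, ℓ) = (ω − θ)·ℓ − (λ·t/g̃)·β(ℓ/t) − μ·t − λ·p_c·t`, where
`β(x) = σ²·(2^{x/B} − 1)`, over `ℓ ∈ [0, ∞)`. -/
theorem offloading_optimal_rate
    (σ2 B g lam μ pc ω θ : ℝ)
    (hσ2 : 0 < σ2) (hB : 0 < B) (hg : 0 < g) (hlam : 0 < lam)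
    (hμ : 0 ≤ μ) (hpc : 0 ≤ pc)
    (hcond : lam * σ2 * Real.log 2 / (B * g) < ω - θ) :
    ∀ t : ℝ, 0 < t → ∀ ℓ : ℝ, 0 ≤ ℓ →
      (ω - θ) * ℓ - (lam * t / g) * (σ2 * ((2 : ℝ) ^ (ℓ / t / B) - 1)) - μ * t -
        lam * pc * t ≤
      (ω - θ) * ((B * Real.logb 2 ((ω - θ) * B * g / (lam * σ2 * Real.log 2))) * t) -
        (lam * t / g) *
          (σ2 * ((2 : ℝ) ^
            ((B * Real.logb 2 ((ω - θ) * B * g / (lam * σ2 * Real.log 2))) * t / t / B)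
            - 1)) - μ * t - lam * pc * t := by
  intro t ht ℓ _
  have hlog : 0 < Real.log 2 := Real.log_pos one_lt_two
  have hw : 0 < ω - θ := lt_trans (by positivity) hcond
  set A := (ω - θ) * B * g / (lam * σ2 * Real.log 2) with hA
  have hApos : 0 < A := by positivity
  obtain ⟨x, rfl⟩ : ∃ x, ℓ = B * x * t := ⟨ℓ / t / B, by field_simp⟩
  have hx : B * x * t / t / B = x := by field_simp
  have hs : B * Real.logb 2 A * t / t / B = Real.logb 2 A := by field_simp
  have hpow : (2 : ℝ) ^ Real.logb 2 A = A := Real.rpow_logb two_pos (by norm_num) hApos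
  rw [hx, hs, hpow]
  have key := two_rpow_tangent_le (Real.logb 2 A) x
  rw [hpow] at key
  have hK : 0 ≤ lam * t / g * σ2 := by positivity
  have hKA : lam * t / g * σ2 * (A * Real.log 2) = (ω - θ) * B * t := by
    rw [hA]; field_simp
  have hmul := mul_le_mul_of_nonneg_left key hK
  linear_combination hmul - (x - Real.logb 2 A) * hKA
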